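/- arXiv:2401.14390 — 5 statements merged into one kernel-verified Lean document; each statement's English description precedes it below -/
import Mathlib

section
/- Every mixed partial derivative of the Black–Scholes put price of total order at least three has the following form: for all nonnegative integers ξ_x, ξ_y with ξ_x + ξ_y ≥ 3 there exist a constant A ∈ ℝ, integers n ∈ ℤ and m ∈ ℕ, and a real polynomial F in three variables whose degree in its first two variables (jointly) is at least one, such that BS_Put is infinitely differentiable on (0,∞) × (0,∞) and for all x > 0, y > 0: ∂^{ξ_x+ξ_y} BS_Put / ∂x^{ξ_x} ∂y^{ξ_y} (x,y) = (A / (x^n · y^{m/2})) · φ(d_+(x,y)) · F(d_+(x,y), d_-(x,y), √y). -/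
/-- Density of the standard normal distribution. -/
noncomputable def stdGaussianPDF (z : ℝ) : ℝ :=
  (Real.sqrt (2 * Real.pi))⁻¹ * Real.exp (-z ^ 2 / 2)

/-- Cumulative distribution function of the standard normal distribution. -/
noncomputable def stdGaussianCDF (z : ℝ) : ℝ :=
  ∫ t in Set.Iic z, stdGaussianPDF t

/-- d₊ from the Black–Scholes formula. -/
noncomputable def dPlus (K r T x y : ℝ) : ℝ :=
  (Real.log (x / K) + r * T + y / 2) / Real.sqrt y

/-- d₋ from the Black–Scholes formula. -/
noncomputable def dMinus (K r T x y : ℝ) : ℝ :=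
  (Real.log (x / K) + r * T - y / 2) / Real.sqrt y

/-- Black–Scholes put price with strike `K`, interest rate `r`, maturity `T`,
spot `x` and integrated variance `y`. -/
noncomputable def BSPut (K r T x y : ℝ) : ℝ :=
  K * Real.exp (-(r * T)) * stdGaussianCDF (-(dMinus K r T x y)) -
    x * stdGaussianCDF (-(dPlus K r T x y))

/-- Mixed partial derivative: `nx` derivatives in the first variable and
`ny` derivatives in the second variable. -/
noncomputable def mixedPartial (f : ℝ → ℝ → ℝ) (nx ny : ℕ) (x y : ℝ) : ℝ :=
  iteratedDeriv nx (fun x' => iteratedDeriv ny (fun y' => f x' y') y) x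

open Set Filter Topology MeasureTheory

theorem continuous_stdGaussianPDF : Continuous stdGaussianPDF := by
  unfold stdGaussianPDF
  fun_prop

theorem contDiff_stdGaussianPDF {n : WithTop ℕ∞} : ContDiff ℝ n stdGaussianPDF := by
  unfold stdGaussianPDF
  fun_prop

theorem integrable_stdGaussianPDF : Integrable stdGaussianPDF := by
  have h := (integrable_exp_neg_mul_sq (b := 1 / 2) (by norm_num)).const_mul
    (Real.sqrt (2 * Real.pi))⁻¹
  refine h.congr (Eventually.of_forall fun z => ?_)
  simp only [stdGaussianPDF]
  congr 2
  ring

theorem stdGaussianPDF_neg (z : ℝ) : stdGaussianPDF (-z) = stdGaussianPDF z := by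
  simp [stdGaussianPDF]

theorem hasDerivAt_stdGaussianPDF (z : ℝ) :
    HasDerivAt stdGaussianPDF (-z * stdGaussianPDF z) z := by
  unfold stdGaussianPDF
  have h : HasDerivAt (fun z : ℝ => -z ^ 2 / 2) (-z) z := by
    refine ((hasDerivAt_pow 2 z).neg.div_const 2).congr_deriv ?_
    norm_num
    ring
  refine (h.exp.const_mul (Real.sqrt (2 * Real.pi))⁻¹).congr_deriv ?_
  ring

theorem hasDerivAt_stdGaussianCDF (z : ℝ) :
    HasDerivAt stdGaussianCDF (stdGaussianPDF z) z := by
  have h : stdGaussianCDF =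
      fun z => stdGaussianCDF 0 + ∫ t in (0 : ℝ)..z, stdGaussianPDF t := by
    funext z
    rw [← intervalIntegral.integral_Iic_sub_Iic integrable_stdGaussianPDF.integrableOn
      integrable_stdGaussianPDF.integrableOn]
    simp [stdGaussianCDF]
  rw [h]
  exact (intervalIntegral.integral_hasDerivAt_right
    (continuous_stdGaussianPDF.intervalIntegrable _ _)
    (continuous_stdGaussianPDF.stronglyMeasurableAtFilter _ _)
    continuous_stdGaussianPDF.continuousAt).const_add _

theorem contDiff_stdGaussianCDF : ContDiff ℝ (⊤ : ℕ∞) stdGaussianCDF := by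
  rw [contDiff_infty_iff_deriv]
  refine ⟨fun z => (hasDerivAt_stdGaussianCDF z).differentiableAt, ?_⟩
  rw [funext fun z => (hasDerivAt_stdGaussianCDF z).deriv]
  exact contDiff_stdGaussianPDF

theorem MvPolynomial.hasDerivAt_eval {σ : Type*} [Fintype σ] [DecidableEq σ]
    {g : ℝ → σ → ℝ} {g' : σ → ℝ} {t : ℝ} (hg : ∀ i, HasDerivAt (fun s => g s i) (g' i) t)
    (F : MvPolynomial σ ℝ) :
    HasDerivAt (fun s => MvPolynomial.eval (g s) F)
      (∑ i, g' i * MvPolynomial.eval (g t) (MvPolynomial.pderiv i F)) t := by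
  induction F using MvPolynomial.induction_on with
  | C a => simpa using hasDerivAt_const t a
  | add p q hp hq =>
    simpa [mul_add, Finset.sum_add_distrib, Pi.add_def] using hp.add hq
  | mul_X p i hp =>
    have hfun : (fun s => MvPolynomial.eval (g s) (p * MvPolynomial.X i)) =
        fun s => MvPolynomial.eval (g s) p * g s i := by
      funext s
      simp
    rw [hfun]
    refine (hp.mul (hg i)).congr_deriv ?_
    simp only [MvPolynomial.pderiv_mul, MvPolynomial.pderiv_X, map_add, map_mul,
      MvPolynomial.eval_X, mul_add, Finset.sum_add_distrib, Finset.sum_mul]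
    congr 1
    · exact Finset.sum_congr rfl fun j _ => by ring
    · rw [Finset.sum_eq_single i]
      · simp [mul_comm]
      · intro j _ hj
        simp [hj.symm]
      · simp

section BlackScholes

theorem contDiffOn_bsPut {K r T : ℝ} (hK : 0 < K) :
    ContDiffOn ℝ (⊤ : ℕ∞) (fun p : ℝ × ℝ => BSPut K r T p.1 p.2) (Ioi 0 ×ˢ Ioi 0) := by
  have hlog : ContDiffOn ℝ (⊤ : ℕ∞) (fun p : ℝ × ℝ => Real.log (p.1 / K))
      (Ioi 0 ×ˢ Ioi 0) :=
    (contDiffOn_fst.div_const K).log fun p hp => (div_pos hp.1 hK).ne'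
  have hsqrt : ContDiffOn ℝ (⊤ : ℕ∞) (fun p : ℝ × ℝ => Real.sqrt p.2) (Ioi 0 ×ˢ Ioi 0) :=
    contDiffOn_snd.sqrt fun p hp => (mem_Ioi.1 hp.2).ne'
  have hne : ∀ p ∈ (Ioi 0 ×ˢ Ioi 0 : Set (ℝ × ℝ)), Real.sqrt p.2 ≠ 0 := fun p hp =>
    (Real.sqrt_pos.2 hp.2).ne'
  have hp : ContDiffOn ℝ (⊤ : ℕ∞) (fun p : ℝ × ℝ => dPlus K r T p.1 p.2)
      (Ioi 0 ×ˢ Ioi 0) :=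
    ((hlog.add contDiffOn_const).add (contDiffOn_snd.div_const 2)).div hsqrt hne
  have hm : ContDiffOn ℝ (⊤ : ℕ∞) (fun p : ℝ × ℝ => dMinus K r T p.1 p.2)
      (Ioi 0 ×ˢ Ioi 0) :=
    ((hlog.add contDiffOn_const).sub (contDiffOn_snd.div_const 2)).div hsqrt hne
  exact (contDiffOn_const.mul (contDiff_stdGaussianCDF.comp_contDiffOn hm.neg)).sub
    (contDiffOn_fst.mul (contDiff_stdGaussianCDF.comp_contDiffOn hp.neg))

variable {K r T x y : ℝ}

theorem hasDerivAt_log_div (hK : 0 < K) (hx : 0 < x) :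
    HasDerivAt (fun x => Real.log (x / K)) x⁻¹ x := by
  refine (((hasDerivAt_id x).div_const K).log (div_pos hx hK).ne').congr_deriv ?_
  simp only [id]
  field_simp

theorem hasDerivAt_dPlus_fst (hK : 0 < K) (hx : 0 < x) :
    HasDerivAt (fun x => dPlus K r T x y) (x⁻¹ / √y) x :=
  (((hasDerivAt_log_div hK hx).add_const _).add_const _).div_const _

theorem hasDerivAt_dMinus_fst (hK : 0 < K) (hx : 0 < x) :
    HasDerivAt (fun x => dMinus K r T x y) (x⁻¹ / √y) x :=
  (((hasDerivAt_log_div hK hx).add_const _).sub_const _).div_const _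

theorem hasDerivAt_dPlus_snd (hy : 0 < y) :
    HasDerivAt (fun y => dPlus K r T x y) (-dMinus K r T x y / (2 * y)) y := by
  have hs : 0 < √y := Real.sqrt_pos.2 hy
  refine ((((hasDerivAt_id y).div_const 2).const_add (Real.log (x / K) + r * T)).div
    (Real.hasDerivAt_sqrt hy.ne') hs.ne').congr_deriv ?_
  simp only [dMinus, id, Real.sq_sqrt hy.le]
  field_simp
  simp only [Real.sq_sqrt hy.le]
  ring

theorem hasDerivAt_dMinus_snd (hy : 0 < y) :
    HasDerivAt (fun y => dMinus K r T x y) (-dPlus K r T x y / (2 * y)) y := by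
  have hs : 0 < √y := Real.sqrt_pos.2 hy
  refine ((((hasDerivAt_id y).div_const 2).const_sub (Real.log (x / K) + r * T)).div
    (Real.hasDerivAt_sqrt hy.ne') hs.ne').congr_deriv ?_
  simp only [dPlus, id, Real.sq_sqrt hy.le]
  field_simp
  simp only [Real.sq_sqrt hy.le]
  ring

theorem dPlus_sub_dMinus (hy : 0 < y) : dPlus K r T x y - dMinus K r T x y = √y := by
  have hs : 0 < √y := Real.sqrt_pos.2 hy
  unfold dPlus dMinus
  field_simp
  rw [Real.sq_sqrt hy.le]
  ring

theorem strike_mul_stdGaussianPDF_dMinus (hK : 0 < K) (hx : 0 < x) (hy : 0 < y) :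
    K * Real.exp (-(r * T)) * stdGaussianPDF (dMinus K r T x y) =
      x * stdGaussianPDF (dPlus K r T x y) := by
  have hs : 0 < √y := Real.sqrt_pos.2 hy
  have h : -dMinus K r T x y ^ 2 / 2 =
      -dPlus K r T x y ^ 2 / 2 + (Real.log (x / K) + r * T) := by
    simp only [dPlus, dMinus, div_pow, Real.sq_sqrt hy.le]
    field_simp
    ring
  unfold stdGaussianPDF
  rw [h, Real.exp_add, Real.exp_add, Real.exp_log (div_pos hx hK), Real.exp_neg (r * T)]
  field_simp

theorem hasDerivAt_bsPut_fst (hK : 0 < K) (hx : 0 < x) (hy : 0 < y) :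
    HasDerivAt (fun x => BSPut K r T x y) (-stdGaussianCDF (-dPlus K r T x y)) x := by
  have hm := (hasDerivAt_stdGaussianCDF _).comp x
    (hasDerivAt_dMinus_fst (r := r) (T := T) (y := y) hK hx).neg
  have hp := (hasDerivAt_stdGaussianCDF _).comp x
    (hasDerivAt_dPlus_fst (r := r) (T := T) (y := y) hK hx).neg
  refine ((hm.const_mul (K * Real.exp (-(r * T)))).sub ((hasDerivAt_id x).mul hp)).congr_deriv ?_
  simp only [Pi.neg_apply, stdGaussianPDF_neg, id, Function.comp]
  linear_combination -(x⁻¹ / √y) *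
    strike_mul_stdGaussianPDF_dMinus (r := r) (T := T) hK hx hy

theorem hasDerivAt_bsPut_snd (hK : 0 < K) (hx : 0 < x) (hy : 0 < y) :
    HasDerivAt (fun y => BSPut K r T x y)
      (x * stdGaussianPDF (dPlus K r T x y) / (2 * √y)) y := by
  have hs : 0 < √y := Real.sqrt_pos.2 hy
  have hm := (hasDerivAt_stdGaussianCDF _).comp y
    (hasDerivAt_dMinus_snd (K := K) (r := r) (T := T) (x := x) hy).neg
  have hp := (hasDerivAt_stdGaussianCDF _).comp y
    (hasDerivAt_dPlus_snd (K := K) (r := r) (T := T) (x := x) hy).neg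
  refine ((hm.const_mul (K * Real.exp (-(r * T)))).sub (hp.const_mul x)).congr_deriv ?_
  simp only [Pi.neg_apply, stdGaussianPDF_neg]
  have hd : (dPlus K r T x y - dMinus K r T x y) / (2 * y) = 1 / (2 * √y) := by
    rw [dPlus_sub_dMinus hy]
    nth_rewrite 2 [← Real.sq_sqrt hy.le]
    field_simp
  linear_combination dPlus K r T x y / (2 * y) *
    strike_mul_stdGaussianPDF_dMinus (r := r) (T := T) hK hx hy +
    x * stdGaussianPDF (dPlus K r T x y) * hd

/-- The functions `xⁿ y^{-m/2} φ(d₊) F(d₊, d₋, √y)` on the open positive quadrant, with `F` a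
polynomial. -/
def IsGaussianPolynomial (K r T : ℝ) (f : ℝ → ℝ → ℝ) : Prop :=
  ∃ (n : ℤ) (m : ℕ) (F : MvPolynomial (Fin 3) ℝ), ∀ x y : ℝ, 0 < x → 0 < y →
    f x y = x ^ n * √y ^ (-(m : ℤ)) * stdGaussianPDF (dPlus K r T x y) *
      MvPolynomial.eval ![dPlus K r T x y, dMinus K r T x y, √y] F

open MvPolynomial in
theorem IsGaussianPolynomial.deriv_fst {f : ℝ → ℝ → ℝ} (hK : 0 < K)
    (hf : IsGaussianPolynomial K r T f) :
    IsGaussianPolynomial K r T fun x y => deriv (fun x => f x y) x := by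
  obtain ⟨n, m, F, hF⟩ := hf
  refine ⟨n - 1, m + 1, C (n : ℝ) * X 2 * F - X 0 * F + pderiv 0 F + pderiv 1 F,
    fun x y hx hy => ?_⟩
  have hs : 0 < √y := Real.sqrt_pos.2 hy
  have hev : (fun x => f x y) =ᶠ[𝓝 x] fun x =>
      x ^ n * √y ^ (-(m : ℤ)) * stdGaussianPDF (dPlus K r T x y) *
        eval ![dPlus K r T x y, dMinus K r T x y, √y] F := by
    filter_upwards [lt_mem_nhds hx] with x hx using hF x y hx hy
  have hp := hasDerivAt_dPlus_fst (r := r) (T := T) (y := y) hK hx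
  have hm := hasDerivAt_dMinus_fst (r := r) (T := T) (y := y) hK hx
  have hE := hasDerivAt_eval (g := fun x => ![dPlus K r T x y, dMinus K r T x y, √y])
    (g' := ![x⁻¹ / √y, x⁻¹ / √y, 0]) (t := x)
    (by intro i; fin_cases i; exacts [hp, hm, hasDerivAt_const x (√y)]) F
  have h := (((hasDerivAt_zpow n x (Or.inl hx.ne')).mul_const (√y ^ (-(m : ℤ)))).mul
    ((hasDerivAt_stdGaussianPDF _).comp x hp)).mul hE
  refine hev.deriv_eq.trans ?_
  refine h.deriv.trans ?_
  have hm' : (-((m + 1 : ℕ) : ℤ)) = -(m : ℤ) - 1 := by push_cast; ring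
  rw [hm', zpow_sub_one₀ hs.ne', zpow_sub_one₀ hx.ne']
  simp [Fin.sum_univ_three]
  field_simp
  ring

open MvPolynomial in
theorem IsGaussianPolynomial.deriv_snd {f : ℝ → ℝ → ℝ}
    (hf : IsGaussianPolynomial K r T f) :
    IsGaussianPolynomial K r T fun x y => deriv (fun y => f x y) y := by
  obtain ⟨n, m, F, hF⟩ := hf
  refine ⟨n, m + 2, C (1 / 2 : ℝ) * (C (-m : ℝ) * F + X 0 * X 1 * F - X 1 * pderiv 0 F
    - X 0 * pderiv 1 F + X 2 * pderiv 2 F), fun x y hx hy => ?_⟩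
  have hs : 0 < √y := Real.sqrt_pos.2 hy
  have hev : (fun y => f x y) =ᶠ[𝓝 y] fun y =>
      x ^ n * √y ^ (-(m : ℤ)) * stdGaussianPDF (dPlus K r T x y) *
        eval ![dPlus K r T x y, dMinus K r T x y, √y] F := by
    filter_upwards [lt_mem_nhds hy] with y hy using hF x y hx hy
  have hp := hasDerivAt_dPlus_snd (K := K) (r := r) (T := T) (x := x) hy
  have hm := hasDerivAt_dMinus_snd (K := K) (r := r) (T := T) (x := x) hy
  have hq := Real.hasDerivAt_sqrt hy.ne'
  have hE := hasDerivAt_eval (g := fun y => ![dPlus K r T x y, dMinus K r T x y, √y])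
    (g' := ![-dMinus K r T x y / (2 * y), -dPlus K r T x y / (2 * y), 1 / (2 * √y)]) (t := y)
    (by intro i; fin_cases i; exacts [hp, hm, hq]) F
  have h := (((((hasDerivAt_zpow (-(m : ℤ)) (√y) (Or.inl hs.ne')).comp y hq).const_mul
    (x ^ n))).mul ((hasDerivAt_stdGaussianPDF _).comp y hp)).mul hE
  refine hev.deriv_eq.trans ?_
  refine h.deriv.trans ?_
  have hm' : (-((m + 2 : ℕ) : ℤ)) = -(m : ℤ) - 1 - 1 := by push_cast; ring
  rw [hm', zpow_sub_one₀ hs.ne', zpow_sub_one₀ hs.ne']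
  simp only [Function.comp, Pi.mul_apply]
  rw [zpow_sub_one₀ hs.ne']
  generalize dPlus K r T x y = a
  generalize dMinus K r T x y = b
  generalize √y ^ (-(m : ℤ)) = c
  obtain ⟨s, hs₀, rfl⟩ : ∃ s, 0 < s ∧ y = s ^ 2 := ⟨√y, hs, (Real.sq_sqrt hy.le).symm⟩
  simp [Fin.sum_univ_three, Real.sqrt_sq hs₀.le]
  field_simp
  ring

theorem IsGaussianPolynomial.congr {f g : ℝ → ℝ → ℝ} (hf : IsGaussianPolynomial K r T f)
    (h : ∀ x y, 0 < x → 0 < y → g x y = f x y) : IsGaussianPolynomial K r T g := by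
  obtain ⟨n, m, F, hF⟩ := hf
  exact ⟨n, m, F, fun x y hx hy => (h x y hx hy).trans (hF x y hx hy)⟩

theorem isGaussianPolynomial_deriv_bsPut_snd (hK : 0 < K) :
    IsGaussianPolynomial K r T fun x y => deriv (fun y => BSPut K r T x y) y := by
  refine ⟨1, 1, MvPolynomial.C (1 / 2), fun x y hx hy => ?_⟩
  have hs : 0 < √y := Real.sqrt_pos.2 hy
  refine (hasDerivAt_bsPut_snd hK hx hy).deriv.trans ?_
  simp
  field_simp

theorem isGaussianPolynomial_deriv_deriv_bsPut_fst (hK : 0 < K) :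
    IsGaussianPolynomial K r T
      fun x y => deriv (fun x => deriv (fun x => BSPut K r T x y) x) x := by
  refine ⟨-1, 1, 1, fun x y hx hy => ?_⟩
  have hev : (fun x => deriv (fun x => BSPut K r T x y) x) =ᶠ[𝓝 x]
      fun x => -stdGaussianCDF (-dPlus K r T x y) := by
    filter_upwards [lt_mem_nhds hx] with x hx using (hasDerivAt_bsPut_fst hK hx hy).deriv
  refine hev.deriv_eq.trans ?_
  refine ((hasDerivAt_stdGaussianCDF _).comp x
    (hasDerivAt_dPlus_fst hK hx).neg).neg.deriv.trans ?_
  simp [stdGaussianPDF_neg]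
  ring

theorem isGaussianPolynomial_iteratedDeriv_bsPut_snd (hK : 0 < K) (n : ℕ) :
    IsGaussianPolynomial K r T fun x y => iteratedDeriv (n + 1) (fun y => BSPut K r T x y) y := by
  induction n with
  | zero => simpa using isGaussianPolynomial_deriv_bsPut_snd hK
  | succ n ih => simpa only [← iteratedDeriv_succ] using ih.deriv_snd

theorem IsGaussianPolynomial.iteratedDeriv_fst {f : ℝ → ℝ → ℝ} (hK : 0 < K)
    (hf : IsGaussianPolynomial K r T f) (n : ℕ) :
    IsGaussianPolynomial K r T fun x y => iteratedDeriv n (fun x => f x y) x := by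
  induction n with
  | zero => simpa using hf
  | succ n ih => simpa only [← iteratedDeriv_succ] using ih.deriv_fst hK

theorem isGaussianPolynomial_iteratedDeriv_bsPut_fst (hK : 0 < K) (n : ℕ) :
    IsGaussianPolynomial K r T fun x y => iteratedDeriv (n + 2) (fun x => BSPut K r T x y) x := by
  induction n with
  | zero =>
    simpa [iteratedDeriv_succ] using isGaussianPolynomial_deriv_deriv_bsPut_fst hK
  | succ n ih => simpa only [← iteratedDeriv_succ] using ih.deriv_fst hK

theorem isGaussianPolynomial_mixedPartial_bsPut (hK : 0 < K) {a b : ℕ} (h : 2 ≤ a ∨ 1 ≤ b) :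
    IsGaussianPolynomial K r T (mixedPartial (BSPut K r T) a b) := by
  rcases Nat.eq_zero_or_pos b with rfl | hb
  · obtain ⟨a, rfl⟩ := Nat.exists_eq_add_of_le' (h.resolve_right (by omega))
    exact (isGaussianPolynomial_iteratedDeriv_bsPut_fst hK a).congr
      fun x y _ _ => by simp [mixedPartial]
  · obtain ⟨b, rfl⟩ := Nat.exists_eq_add_of_le' hb
    exact (isGaussianPolynomial_iteratedDeriv_bsPut_snd hK b).iteratedDeriv_fst hK a

/-- Since `d₊ - d₋ = √y`, a polynomial in `(d₊, d₋, √y)` can always be represented by one that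
really involves one of the first two variables. -/
theorem exists_eval_eq_of_involves_fst_or_snd (F : MvPolynomial (Fin 3) ℝ) :
    ∃ G : MvPolynomial (Fin 3) ℝ, (∃ mono ∈ G.support, 1 ≤ mono 0 + mono 1) ∧
      ∀ a b : ℝ, MvPolynomial.eval ![a, b, a - b] G = MvPolynomial.eval ![a, b, a - b] F := by
  by_cases h : ∃ mono ∈ F.support, 1 ≤ mono 0 + mono 1
  · exact ⟨F, h, fun _ _ => rfl⟩
  · refine ⟨F + (MvPolynomial.X 0 - MvPolynomial.X 1 - MvPolynomial.X 2),
      ⟨Finsupp.single 0 1, ?_, by simp⟩, fun a b => by simp⟩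
    have h0 : MvPolynomial.coeff (Finsupp.single 0 1) F = 0 := by
      by_contra hne
      exact h ⟨Finsupp.single 0 1, MvPolynomial.mem_support_iff.2 hne, by simp⟩
    simp [MvPolynomial.mem_support_iff, h0, MvPolynomial.coeff_X, Finsupp.single_left_inj]

end BlackScholes

/-- Every mixed partial derivative of the Black–Scholes put price of total order at least
three has the form `(A / (xⁿ y^{m/2})) φ(d₊) F(d₊, d₋, √y)` with `F` a real polynomial in
three variables of degree at least one in its first two variables jointly; moreover `BSPut`
is infinitely differentiable on `(0,∞) × (0,∞)`. -/
theorem bsPut_mixed_partial_form (K r T : ℝ) (hK : 0 < K) (hT : 0 < T)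
    (ξx ξy : ℕ) (hξ : 3 ≤ ξx + ξy) :
    ContDiffOn ℝ (⊤ : ℕ∞) (fun p : ℝ × ℝ => BSPut K r T p.1 p.2)
      (Set.Ioi 0 ×ˢ Set.Ioi 0) ∧
    ∃ (A : ℝ) (n : ℤ) (m : ℕ) (F : MvPolynomial (Fin 3) ℝ),
      (∃ mono ∈ F.support, 1 ≤ mono 0 + mono 1) ∧
      ∀ x y : ℝ, 0 < x → 0 < y →
        mixedPartial (BSPut K r T) ξx ξy x y =
          A / (x ^ n * y ^ ((m : ℝ) / 2)) * stdGaussianPDF (dPlus K r T x y) *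
            MvPolynomial.eval ![dPlus K r T x y, dMinus K r T x y, Real.sqrt y] F := by
  refine ⟨contDiffOn_bsPut hK, ?_⟩
  obtain ⟨n, m, F, hF⟩ := isGaussianPolynomial_mixedPartial_bsPut (r := r) (T := T) hK
    (a := ξx) (b := ξy) (by omega)
  obtain ⟨G, hG, hGF⟩ := exists_eval_eq_of_involves_fst_or_snd F
  refine ⟨1, -n, m, G, hG, fun x y hx hy => ?_⟩
  have hpow : y ^ ((m : ℝ) / 2) = √y ^ m := by
    rw [Real.sqrt_eq_rpow, ← Real.rpow_natCast, ← Real.rpow_mul hy.le]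
    congr 1
    ring
  have h := hGF (dPlus K r T x y) (dMinus K r T x y)
  rw [dPlus_sub_dMinus hy] at h
  rw [hF x y hx hy, h, hpow, zpow_neg, zpow_neg, zpow_natCast, one_div, mul_inv, inv_inv]
end

section
/- For every integer N ≥ 1 there exists a polynomial f_N in three variables with real, nonnegative coefficients, depending only on N, such that for all a, b, λ, T > 0 the sequence (H_h) defined from the gamma cumulant function satisfies |H_N| ≤ (a·T/(λ·b^N)) · f_N(a, 1/λ, T). -/
open Finset in
lemma abs_const_add_sum_choose_mul_integrated_exp_le {lam T : ℝ} (hlam : 0 < lam) (hT : 0 < T)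
    (i : ℕ) :
    |T + ∑ j ∈ Icc 1 i, (1 / (j : ℝ)) * (Nat.choose i j : ℝ) * (-1 : ℝ) ^ j *
      ((1 - Real.exp (-(lam * ((j : ℝ) * T)))) / lam)| ≤ 2 ^ i * T := by
  have hterm : ∀ j ∈ Icc 1 i, |(1 / (j : ℝ)) * (Nat.choose i j : ℝ) * (-1 : ℝ) ^ j *
      ((1 - Real.exp (-(lam * ((j : ℝ) * T)))) / lam)| ≤ (Nat.choose i j : ℝ) * T := by
    intro j hj
    have hj0 : (0 : ℝ) < j := by exact_mod_cast (mem_Icc.1 hj).1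
    have hexp : Real.exp (-(lam * ((j : ℝ) * T))) ≤ 1 :=
      Real.exp_le_one_iff.2 (neg_nonpos.2 (by positivity))
    have hα : |(1 - Real.exp (-(lam * ((j : ℝ) * T)))) / lam| ≤ j * T := by
      rw [abs_of_nonneg (div_nonneg (by linarith) hlam.le), div_le_iff₀ hlam]
      linarith [Real.add_one_le_exp (-(lam * ((j : ℝ) * T)))]
    rw [abs_mul, abs_mul, abs_mul, abs_pow, abs_neg, abs_one, one_pow, mul_one, Nat.abs_cast,
      abs_of_pos (one_div_pos.2 hj0)]
    calc _ ≤ 1 / (j : ℝ) * (Nat.choose i j : ℝ) * (j * T) := by gcongr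
      _ = _ := by field_simp
  have hsum : (1 : ℝ) + ∑ j ∈ Icc 1 i, (Nat.choose i j : ℝ) = 2 ^ i := by
    have h := Nat.sum_range_choose i
    rw [Nat.range_succ_eq_Icc_zero, ← add_sum_Ioc_eq_sum_Icc (Nat.zero_le i),
      ← Icc_add_one_left_eq_Ioc, Nat.choose_zero_right] at h
    exact_mod_cast h
  calc _ ≤ |T| + ∑ j ∈ Icc 1 i, (Nat.choose i j : ℝ) * T :=
        (abs_add_le _ _).trans
          (add_le_add_right ((abs_sum_le_sum_abs _ _).trans (sum_le_sum hterm)) _)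
    _ = 2 ^ i * T := by rw [abs_of_pos hT, ← sum_mul, ← hsum]; ring

/-- The recursion of the central moments of the integrated variance in the gamma
Ornstein–Uhlenbeck model. -/
def IsGammaOUMomentSeq (a b lam T : ℝ) (H : ℕ → ℝ) : Prop :=
  ∀ h : ℕ, 1 ≤ h →
    H h = (a / b) * ((1 - Real.exp (-(lam * T))) / lam - T) * H (h - 1) +
      ∑ i ∈ Finset.Icc 1 h,
        (lam ^ (i - 1))⁻¹ * (Nat.choose (h - 1) (i - 1) : ℝ) * H (h - i) *
          ((Nat.factorial i : ℝ) * a / b ^ i) *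
          (T + ∑ j ∈ Finset.Icc 1 i,
            (1 / (j : ℝ)) * (Nat.choose i j : ℝ) * (-1 : ℝ) ^ j *
              ((1 - Real.exp (-(lam * ((j : ℝ) * T)))) / lam))

namespace IsGammaOUMomentSeq

open Finset

variable {a b lam T : ℝ} {H : ℕ → ℝ}

/-- The drift term cancels the first summand of the recursion. -/
lemma eq_sum_Icc_two (hH : IsGammaOUMomentSeq a b lam T H) {h : ℕ} (hh : 1 ≤ h) :
    H h = ∑ i ∈ Icc 2 h,
      (lam ^ (i - 1))⁻¹ * (Nat.choose (h - 1) (i - 1) : ℝ) * H (h - i) *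
        ((Nat.factorial i : ℝ) * a / b ^ i) *
        (T + ∑ j ∈ Icc 1 i, (1 / (j : ℝ)) * (Nat.choose i j : ℝ) * (-1 : ℝ) ^ j *
          ((1 - Real.exp (-(lam * ((j : ℝ) * T)))) / lam)) := by
  rw [hH h hh, ← add_sum_Ioc_eq_sum_Icc hh, ← add_assoc,
    show Ioc 1 h = Icc 2 h from (Icc_add_one_left_eq_Ioc 1 h).symm]
  simp only [add_eq_right]
  simp
  ring

lemma abs_le_of_forall_lt (ha : 0 < a) (hb : 0 < b) (hlam : 0 < lam) (hT : 0 < T)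
    (hH : IsGammaOUMomentSeq a b lam T H) {N : ℕ} (hN : 1 ≤ N) {p : ℕ → ℝ}
    (hp : ∀ m < N, |H m| ≤ p m / b ^ m) :
    |H N| ≤ a * T / (lam * b ^ N) * ∑ i ∈ Icc 2 N,
      ((Nat.choose (N - 1) (i - 1) * Nat.factorial i * 2 ^ i : ℕ) : ℝ) *
        (1 / lam) ^ (i - 2) * p (N - i) := by
  rw [hH.eq_sum_Icc_two hN, mul_sum]
  refine (abs_sum_le_sum_abs _ _).trans (sum_le_sum fun i hi => ?_)
  obtain ⟨hi2, hiN⟩ := mem_Icc.1 hi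
  have hc := abs_const_add_sum_choose_mul_integrated_exp_le hlam hT i
  have hm := hp (N - i) (by omega)
  have hq : 0 ≤ p (N - i) / b ^ (N - i) := (abs_nonneg _).trans hm
  rw [abs_mul, abs_mul, abs_mul, abs_mul, Nat.abs_cast, abs_of_pos (a := (lam ^ (i - 1))⁻¹)
    (by positivity), abs_of_pos (a := (Nat.factorial i : ℝ) * a / b ^ i) (by positivity)]
  calc _ ≤ (lam ^ (i - 1))⁻¹ * (Nat.choose (N - 1) (i - 1) : ℝ) * (p (N - i) / b ^ (N - i)) *
          ((Nat.factorial i : ℝ) * a / b ^ i) * (2 ^ i * T) := by gcongr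
    _ = _ := by
      obtain ⟨k, rfl⟩ := Nat.exists_eq_add_of_le hi2
      obtain ⟨m, rfl⟩ := Nat.exists_eq_add_of_le hiN
      rw [show 2 + k - 1 = k + 1 by omega, show 2 + k - 2 = k by omega,
        show 2 + k + m - (2 + k) = m by omega]
      push_cast
      rw [one_div, inv_pow]
      field_simp
      ring

end IsGammaOUMomentSeq

open MvPolynomial in
/-- If the moments of order below `N` have polynomial bounds, then so has the moment of order `N`,
with a factor `a * T / lam` split off. -/
lemma exists_polynomial_bound_of_forall_lt {N : ℕ} (hN : 1 ≤ N)
    (ih : ∀ m < N, ∃ p : MvPolynomial (Fin 3) ℕ, ∀ a b lam T : ℝ,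
      0 < a → 0 < b → 0 < lam → 0 < T → ∀ H : ℕ → ℝ, H 0 = 1 → IsGammaOUMomentSeq a b lam T H →
        |H m| ≤ aeval ![a, 1 / lam, T] p / b ^ m) :
    ∃ f : MvPolynomial (Fin 3) ℕ, ∀ a b lam T : ℝ,
      0 < a → 0 < b → 0 < lam → 0 < T → ∀ H : ℕ → ℝ, H 0 = 1 → IsGammaOUMomentSeq a b lam T H →
        |H N| ≤ a * T / (lam * b ^ N) * aeval ![a, 1 / lam, T] f := by
  choose! p hp using ih
  refine ⟨∑ i ∈ Finset.Icc 2 N, ((Nat.choose (N - 1) (i - 1) * Nat.factorial i * 2 ^ i : ℕ) :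
    MvPolynomial (Fin 3) ℕ) * X 1 ^ (i - 2) * p (N - i), ?_⟩
  intro a b lam T ha hb hlam hT H h0 hH
  have h := hH.abs_le_of_forall_lt ha hb hlam hT hN
    (p := fun m => aeval ![a, 1 / lam, T] (p m))
    fun m hm => hp m hm a b lam T ha hb hlam hT H h0 hH
  simpa only [map_sum, map_mul, map_pow, map_natCast, aeval_X, Matrix.cons_val_one,
    Matrix.cons_val_zero] using h

open MvPolynomial in
lemma exists_polynomial_bound (N : ℕ) :
    ∃ p : MvPolynomial (Fin 3) ℕ, ∀ a b lam T : ℝ,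
      0 < a → 0 < b → 0 < lam → 0 < T → ∀ H : ℕ → ℝ, H 0 = 1 → IsGammaOUMomentSeq a b lam T H →
        |H N| ≤ aeval ![a, 1 / lam, T] p / b ^ N := by
  induction N using Nat.strong_induction_on with
  | _ N ih =>
    rcases Nat.eq_zero_or_pos N with rfl | hN
    · exact ⟨1, fun a b lam T _ _ _ _ H h0 _ => by simp [h0]⟩
    · obtain ⟨f, hf⟩ := exists_polynomial_bound_of_forall_lt hN ih
      refine ⟨X 0 * X 2 * X 1 * f, fun a b lam T ha hb hlam hT H h0 hH =>
        (hf a b lam T ha hb hlam hT H h0 hH).trans_eq ?_⟩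
      simp
      field_simp


/-- For every `N ≥ 1` there is a polynomial `f_N` in three variables with nonnegative real
coefficients, depending only on `N`, such that for all `a, b, λ, T > 0` the sequence `(H_h)`
built from the gamma cumulant function (with `κ⁽ⁱ⁾(0) = i!·a/bⁱ` and
`α_{0,t} = (1 − e^{−λt})/λ`) satisfies `|H_N| ≤ (a·T/(λ·b^N)) · f_N(a, 1/λ, T)`. -/
theorem gammaOU_central_moment_bound (N : ℕ) (hN : 1 ≤ N) :
    ∃ f : MvPolynomial (Fin 3) ℝ,
      (∀ mono, 0 ≤ MvPolynomial.coeff mono f) ∧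
      ∀ (a b lam T : ℝ), 0 < a → 0 < b → 0 < lam → 0 < T →
        ∀ H : ℕ → ℝ, H 0 = 1 →
          (∀ h : ℕ, 1 ≤ h →
            H h = (a / b) * ((1 - Real.exp (-(lam * T))) / lam - T) * H (h - 1) +
              ∑ i ∈ Finset.Icc 1 h,
                (lam ^ (i - 1))⁻¹ * (Nat.choose (h - 1) (i - 1) : ℝ) * H (h - i) *
                  ((Nat.factorial i : ℝ) * a / b ^ i) *
                  (T + ∑ j ∈ Finset.Icc 1 i,
                    (1 / (j : ℝ)) * (Nat.choose i j : ℝ) * (-1 : ℝ) ^ j *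
                      ((1 - Real.exp (-(lam * ((j : ℝ) * T)))) / lam))) →
          |H N| ≤ a * T / (lam * b ^ N) * MvPolynomial.eval ![a, 1 / lam, T] f := by
  obtain ⟨f, hf⟩ := exists_polynomial_bound_of_forall_lt hN fun m _ => exists_polynomial_bound m
  refine ⟨MvPolynomial.map (Nat.castRingHom ℝ) f, fun mono => ?_, ?_⟩
  · rw [MvPolynomial.coeff_map]
    exact Nat.cast_nonneg _
  · intro a b lam T ha hb hlam hT H h0 hH
    have h := hf a b lam T ha hb hlam hT H h0 hH
    rwa [MvPolynomial.aeval_def, ← MvPolynomial.eval_map] at h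
end

section
/- For every integer N ≥ 1 there exists a polynomial g_N in five variables with real, nonnegative coefficients, depending only on N, such that for all a, b, λ, T > 0 and all ρ ≤ 0 the sequence (G_h) defined from the gamma cumulant function satisfies G_N ≤ (a·λ·T·|ρ|/b^N) · g_N(a, λ, T, |ρ|, e^{−λTκ(ρ)}). -/
open MvPolynomial in
/-- Polynomials with nonnegative coefficients form a subsemiring. -/
def nonnegCoeffSubsemiring (σ : Type*) : Subsemiring (MvPolynomial σ ℝ) where
  carrier := {p | ∀ m, 0 ≤ coeff m p}
  mul_mem' {p q} hp hq m := by
    classical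
    rw [coeff_mul]
    exact Finset.sum_nonneg fun x _ => mul_nonneg (hp x.1) (hq x.2)
  one_mem' m := by
    classical
    rw [coeff_one]
    split_ifs <;> norm_num
  add_mem' {p q} hp hq m := by
    rw [coeff_add]
    exact add_nonneg (hp m) (hq m)
  zero_mem' m := by simp

open MvPolynomial in
theorem X_mem_nonnegCoeffSubsemiring {σ : Type*} (i : σ) :
    (X i : MvPolynomial σ ℝ) ∈ nonnegCoeffSubsemiring σ := fun m => by
  classical
  rw [coeff_X]
  split_ifs <;> norm_num

open MvPolynomial in
theorem C_mem_nonnegCoeffSubsemiring {σ : Type*} {c : ℝ} (hc : 0 ≤ c) :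
    (C c : MvPolynomial σ ℝ) ∈ nonnegCoeffSubsemiring σ := fun m => by
  classical
  rw [coeff_C]
  split_ifs <;> simp [hc]

open MvPolynomial in
/-- The polynomial in `a, λ, T, |ρ|, e^{-λTκ(ρ)}` that bounds `b ^ h * G h`. -/
noncomputable def momentPoly : ℕ → MvPolynomial (Fin 5) ℝ
  | 0 => 1
  | n + 1 => X 0 * X 1 * X 2 * X 3 *
      (C (1 / 2) * (X 4 + 1) * momentPoly n +
        ∑ i : Fin (n + 1), C ((n.choose i : ℝ) * (i + 1 : ℕ).factorial) * X 3 ^ (i : ℕ) *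
          momentPoly (n - i))

open MvPolynomial in
/-- The cofactor of `aλT|ρ|` in `momentPoly (n + 1)`. -/
noncomputable def momentCofactor (n : ℕ) : MvPolynomial (Fin 5) ℝ :=
  C (1 / 2) * (X 4 + 1) * momentPoly n +
    ∑ i ∈ Finset.range (n + 1), C ((n.choose i : ℝ) * (i + 1).factorial) * X 3 ^ i *
      momentPoly (n - i)

open MvPolynomial in
theorem momentPoly_succ (n : ℕ) :
    momentPoly (n + 1) = X 0 * X 1 * X 2 * X 3 * momentCofactor n := by
  rw [momentPoly, momentCofactor, Finset.sum_range]

theorem momentCofactor_mem_of_momentPoly_mem {n : ℕ}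
    (h : ∀ k ≤ n, momentPoly k ∈ nonnegCoeffSubsemiring (Fin 5)) :
    momentCofactor n ∈ nonnegCoeffSubsemiring (Fin 5) := by
  refine add_mem (mul_mem (mul_mem (C_mem_nonnegCoeffSubsemiring (by norm_num))
    (add_mem (X_mem_nonnegCoeffSubsemiring 4) (one_mem _))) (h n le_rfl)) (sum_mem fun i _ => ?_)
  exact mul_mem (mul_mem (C_mem_nonnegCoeffSubsemiring (by positivity))
    (pow_mem (X_mem_nonnegCoeffSubsemiring 3) i)) (h _ (Nat.sub_le n i))

theorem momentPoly_mem (n : ℕ) : momentPoly n ∈ nonnegCoeffSubsemiring (Fin 5) := by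
  induction n using Nat.strong_induction_on with
  | _ n ih =>
    cases n with
    | zero =>
      rw [momentPoly]
      exact one_mem _
    | succ n =>
      rw [momentPoly_succ]
      have hX := X_mem_nonnegCoeffSubsemiring (σ := Fin 5)
      exact mul_mem (mul_mem (mul_mem (mul_mem (hX 0) (hX 1)) (hX 2)) (hX 3))
        (momentCofactor_mem_of_momentPoly_mem fun k hk => ih k (Nat.lt_succ_of_le hk))

theorem momentCofactor_mem (n : ℕ) : momentCofactor n ∈ nonnegCoeffSubsemiring (Fin 5) :=
  momentCofactor_mem_of_momentPoly_mem fun k _ => momentPoly_mem k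

/-- A sequence satisfying the moment recursion, with `K` in place of `-λTκ(ρ)` and `E` in place of
its exponential, is bounded by `momentPoly`. -/
theorem le_momentPoly_of_recursion {a b lam T r K E : ℝ} (ha : 0 < a) (hb : 0 < b)
    (hlam : 0 < lam) (hT : 0 < T) (hr : 0 ≤ r) (hK : 0 ≤ K) (hKb : K ≤ a * lam * T * r / b)
    (hE : 0 ≤ E) {G : ℕ → ℝ} (hG0 : G 0 = 1)
    (hG : ∀ n : ℕ, G (n + 1) = K * ((1 / 2) * E + 1 / 2) * G n +
      ∑ i ∈ Finset.range (n + 1), (n.choose i : ℝ) * G (n - i) *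
        (((i + 1).factorial : ℝ) * a / b ^ (i + 1)) * (lam * T) * r ^ (i + 1)) (n : ℕ) :
    0 ≤ G n ∧ G n ≤ MvPolynomial.eval ![a, lam, T, r, E] (momentPoly n) / b ^ n := by
  induction n using Nat.strong_induction_on with
  | _ n ih =>
    cases n with
    | zero => simp [hG0, momentPoly]
    | succ n =>
      have hnonneg : ∀ k ≤ n, 0 ≤ G k := fun k hk => (ih k (Nat.lt_succ_of_le hk)).1
      have hle := fun k (hk : k ≤ n) => (ih k (Nat.lt_succ_of_le hk)).2
      rw [hG]
      constructor
      · refine add_nonneg (mul_nonneg (by positivity) (hnonneg n le_rfl))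
          (Finset.sum_nonneg fun i _ => ?_)
        have := hnonneg (n - i) (Nat.sub_le n i)
        positivity
      · rw [momentPoly_succ, momentCofactor]
        simp only [map_mul, map_add, map_sum, map_pow, map_one, MvPolynomial.eval_X,
          MvPolynomial.eval_C]
        simp only [Matrix.cons_val]
        rw [mul_add (a * lam * T * r), add_div, Finset.mul_sum, Finset.sum_div]
        refine add_le_add ?_ (Finset.sum_le_sum fun i hi => ?_)
        · calc K * ((1 / 2) * E + 1 / 2) * G n
              ≤ a * lam * T * r / b * ((1 / 2) * E + 1 / 2) *
                  (MvPolynomial.eval ![a, lam, T, r, E] (momentPoly n) / b ^ n) := by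
                have := hnonneg n le_rfl
                gcongr
                exact hle n le_rfl
            _ = _ := by
                rw [pow_succ b n]
                field_simp
        · have hin : i ≤ n := Nat.lt_succ_iff.mp (Finset.mem_range.mp hi)
          calc (n.choose i : ℝ) * G (n - i) *
                (((i + 1).factorial : ℝ) * a / b ^ (i + 1)) * (lam * T) * r ^ (i + 1)
              ≤ (n.choose i : ℝ) *
                  (MvPolynomial.eval ![a, lam, T, r, E] (momentPoly (n - i)) / b ^ (n - i)) *
                (((i + 1).factorial : ℝ) * a / b ^ (i + 1)) * (lam * T) * r ^ (i + 1) := by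
                gcongr
                exact hle _ (Nat.sub_le n i)
            _ = _ := by
                have hpow : b ^ (n + 1) = b ^ (n - i) * b ^ (i + 1) := by
                  rw [← pow_add]
                  congr 1
                  omega
                rw [hpow, pow_succ r i]
                field_simp


/-- For every `N ≥ 1` there is a polynomial `g_N` in five variables with nonnegative real
coefficients, depending only on `N`, such that for all `a, b, λ, T > 0` and all `ρ ≤ 0` the
sequence `(G_h)` built from the gamma cumulant function `κ(θ) = aθ/(b−θ)` (with
`κ⁽ⁱ⁾(0) = i!·a/bⁱ`) satisfies `G_N ≤ (a·λ·T·|ρ|/b^N) · g_N(a, λ, T, |ρ|, e^{−λTκ(ρ)})`. -/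
theorem gammaOU_price_moment_bound (N : ℕ) (hN : 1 ≤ N) :
    ∃ g : MvPolynomial (Fin 5) ℝ,
      (∀ mono, 0 ≤ MvPolynomial.coeff mono g) ∧
      ∀ (a b lam T ρ : ℝ), 0 < a → 0 < b → 0 < lam → 0 < T → ρ ≤ 0 →
        ∀ G : ℕ → ℝ, G 0 = 1 →
          (∀ h : ℕ, 1 ≤ h →
            G h = -(lam * T * (a * ρ / (b - ρ))) *
                ((1 / 2) * Real.exp (-(lam * T * (a * ρ / (b - ρ)))) + 1 / 2) * G (h - 1) +
              ∑ i ∈ Finset.Icc 1 h,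
                (Nat.choose (h - 1) (i - 1) : ℝ) * G (h - i) *
                  ((Nat.factorial i : ℝ) * a / b ^ i) * (lam * T) * |ρ| ^ i) →
          G N ≤ a * lam * T * |ρ| / b ^ N *
            MvPolynomial.eval
              ![a, lam, T, |ρ|, Real.exp (-(lam * T * (a * ρ / (b - ρ))))] g := by
  obtain ⟨n, rfl⟩ : ∃ n, N = n + 1 := ⟨N - 1, by omega⟩
  refine ⟨momentCofactor n, momentCofactor_mem n, ?_⟩
  intro a b lam T ρ ha hb hlam hT hρ G hG0 hG
  have hK : -(lam * T * (a * ρ / (b - ρ))) = a * lam * T * |ρ| / (b - ρ) := by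
    rw [abs_of_nonpos hρ]
    ring
  have hbρ : b ≤ b - ρ := by linarith
  have hbρ_pos : 0 < b - ρ := hb.trans_le hbρ
  have key := le_momentPoly_of_recursion (K := -(lam * T * (a * ρ / (b - ρ))))
    (E := Real.exp (-(lam * T * (a * ρ / (b - ρ))))) ha hb hlam hT
    (abs_nonneg ρ) (by rw [hK]; positivity) (by rw [hK]; gcongr) (Real.exp_pos _).le hG0
    (fun m => by
      rw [hG (m + 1) (by omega), ← Finset.Ico_add_one_right_eq_Icc, Finset.sum_Ico_eq_sum_range]
      simp [add_comm 1]) (n + 1)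
  refine key.2.trans_eq ?_
  rw [momentPoly_succ]
  simp only [map_mul, MvPolynomial.eval_X, Matrix.cons_val]
  ring
end

section
/- For every integer N ≥ 1 there exists a polynomial g_N in six variables with real, nonnegative coefficients, depending only on N, such that for all a, b, λ, T > 0 and all ρ ≤ 0 the sequence (G_h) defined from the inverse Gaussian cumulant function satisfies G_N ≤ (a·λ·T·|ρ|/b^N) · g_N(a, λ, 1/b, T, |ρ|, e^{−λTκ(ρ)}). -/
/-- The sequence `φ_n` appearing in the derivatives of the inverse Gaussian cumulant
function: `φ_1 = 1` and `φ_n = (2n−3)·φ_{n−1} + (2n−3)!!` for `n ≥ 2`. -/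
noncomputable def varphi : ℕ → ℝ
  | 0 => 0
  | 1 => 1
  | (n + 2) => ((2 * (n + 2) - 3 : ℕ) : ℝ) * varphi (n + 1) +
      ((2 * (n + 2) - 3 : ℕ).doubleFactorial : ℝ)

open MvPolynomial in
/-- The real polynomials with nonnegative coefficients, as a subsemiring. -/
def nonnegCoeff (σ : Type*) : Subsemiring (MvPolynomial σ ℝ) where
  carrier := {p | ∀ m, 0 ≤ coeff m p}
  mul_mem' {p q} hp hq m := by
    classical
    rw [coeff_mul]
    exact Finset.sum_nonneg fun x _ => mul_nonneg (hp _) (hq _)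
  one_mem' m := by
    classical
    rw [coeff_one]
    split_ifs <;> norm_num
  add_mem' {p q} hp hq m := by
    rw [coeff_add]
    exact add_nonneg (hp m) (hq m)
  zero_mem' m := by simp

namespace nonnegCoeff

open MvPolynomial

variable {σ : Type*}

theorem C_mem {r : ℝ} (hr : 0 ≤ r) : (C r : MvPolynomial σ ℝ) ∈ nonnegCoeff σ := fun m => by
  classical
  rw [coeff_C]
  split_ifs <;> simp [hr]

theorem X_mem (i : σ) : (X i : MvPolynomial σ ℝ) ∈ nonnegCoeff σ := fun m => by
  classical
  rw [coeff_X]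
  split_ifs <;> norm_num

theorem eval_nonneg {p : MvPolynomial σ ℝ} (hp : p ∈ nonnegCoeff σ) {v : σ → ℝ}
    (hv : ∀ i, 0 ≤ v i) : 0 ≤ eval v p := by
  rw [eval_eq]
  exact Finset.sum_nonneg fun m _ =>
    mul_nonneg (hp m) (Finset.prod_nonneg fun i _ => pow_nonneg (hv i) _)

end nonnegCoeff

theorem varphi_nonneg : ∀ n, 0 ≤ varphi n
  | 0 => by simp [varphi]
  | 1 => by simp [varphi]
  | n + 2 => by
    have := varphi_nonneg (n + 1)
    rw [varphi]
    positivity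

/-- The recursion defining the moment bounds `G_h`. -/
def IsMomentRec (a b lam T ρ : ℝ) (G : ℕ → ℝ) : Prop :=
  ∀ h : ℕ, 1 ≤ h →
    G h = -(lam * T * (a * ρ / Real.sqrt (b ^ 2 - 2 * ρ))) *
        ((1 / 2) * Real.exp (-(lam * T * (a * ρ / Real.sqrt (b ^ 2 - 2 * ρ)))) +
          1 / 2) * G (h - 1) +
      ∑ i ∈ Finset.Icc 1 h,
        (Nat.choose (h - 1) (i - 1) : ℝ) * G (h - i) *
          (varphi i * a / b ^ (2 * i - 1)) * (lam * T) * |ρ| ^ i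

/-- The point at which the bounding polynomials are evaluated. -/
noncomputable def momentPoint (a b lam T ρ : ℝ) : Fin 6 → ℝ :=
  ![a, lam, 1 / b, T, |ρ|,
    Real.exp (-(lam * T * (a * ρ / Real.sqrt (b ^ 2 - 2 * ρ))))]

/-- `q` has nonnegative coefficients and `G_n ≤ b⁻ⁿ · q` for all admissible parameters. -/
def IsMomentBound (n : ℕ) (q : MvPolynomial (Fin 6) ℝ) : Prop :=
  q ∈ nonnegCoeff (Fin 6) ∧
    ∀ a b lam T ρ : ℝ, 0 < a → 0 < b → 0 < lam → 0 < T → ρ ≤ 0 →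
      ∀ G : ℕ → ℝ, G 0 = 1 → IsMomentRec a b lam T ρ G →
        G n ≤ 1 / b ^ n * MvPolynomial.eval (momentPoint a b lam T ρ) q

theorem momentPoint_nonneg {a b lam T ρ : ℝ} (ha : 0 < a) (hb : 0 < b) (hl : 0 < lam)
    (hT : 0 < T) (i : Fin 6) : 0 ≤ momentPoint a b lam T ρ i := by
  fin_cases i <;> simp [momentPoint] <;> positivity

theorem neg_cumulant_nonneg {a b lam T ρ : ℝ} (ha : 0 < a) (hl : 0 < lam)
    (hT : 0 < T) (hρ : ρ ≤ 0) :
    0 ≤ -(lam * T * (a * ρ / Real.sqrt (b ^ 2 - 2 * ρ))) := by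
  have : -(lam * T * (a * ρ / Real.sqrt (b ^ 2 - 2 * ρ))) =
      lam * T * (a * -ρ / Real.sqrt (b ^ 2 - 2 * ρ)) := by ring
  have h := neg_nonneg.2 hρ
  rw [this]
  positivity

theorem neg_cumulant_le {a b lam T ρ : ℝ} (ha : 0 < a) (hb : 0 < b) (hl : 0 < lam)
    (hT : 0 < T) (hρ : ρ ≤ 0) :
    -(lam * T * (a * ρ / Real.sqrt (b ^ 2 - 2 * ρ))) ≤ a * lam * T * |ρ| / b := by
  have hs : b ≤ Real.sqrt (b ^ 2 - 2 * ρ) := Real.le_sqrt_of_sq_le (by linarith)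
  calc -(lam * T * (a * ρ / Real.sqrt (b ^ 2 - 2 * ρ)))
      = a * lam * T * |ρ| / Real.sqrt (b ^ 2 - 2 * ρ) := by rw [abs_of_nonpos hρ]; ring
    _ ≤ a * lam * T * |ρ| / b := by gcongr

open MvPolynomial in
theorem exists_isMomentBound_step {n : ℕ} {q : ℕ → MvPolynomial (Fin 6) ℝ}
    (hq : ∀ m < n + 1, IsMomentBound m (q m)) :
    ∃ g ∈ nonnegCoeff (Fin 6), IsMomentBound (n + 1) (X 0 * X 1 * X 3 * X 4 * g) := by
  have hg : (C (1 / 2) * X 5 + C (1 / 2)) * q n + ∑ i ∈ Finset.Icc 1 (n + 1),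
      C ((Nat.choose n (i - 1) : ℝ) * varphi i) * q (n + 1 - i) *
        (X 2 * X 4) ^ (i - 1) ∈ nonnegCoeff (Fin 6) := by
    have hhalf : (C (1 / 2) : MvPolynomial (Fin 6) ℝ) ∈ nonnegCoeff (Fin 6) :=
      nonnegCoeff.C_mem (by norm_num)
    refine add_mem (mul_mem (add_mem (mul_mem hhalf (nonnegCoeff.X_mem 5)) hhalf)
      (hq n (by lia)).1) (sum_mem fun i hi => ?_)
    rw [Finset.mem_Icc] at hi
    exact mul_mem (mul_mem (nonnegCoeff.C_mem (mul_nonneg (by positivity) (varphi_nonneg i)))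
      (hq _ (by lia)).1) (pow_mem (mul_mem (nonnegCoeff.X_mem 2) (nonnegCoeff.X_mem 4)) _)
  refine ⟨_, hg, mul_mem (mul_mem (mul_mem (mul_mem (nonnegCoeff.X_mem 0) (nonnegCoeff.X_mem 1))
    (nonnegCoeff.X_mem 3)) (nonnegCoeff.X_mem 4)) hg, ?_⟩
  intro a b lam T ρ ha hb hl hT hρ G hG0 hG
  have hbound : ∀ m < n + 1, G m ≤ 1 / b ^ m * eval (momentPoint a b lam T ρ) (q m) :=
    fun m hm => (hq m hm).2 a b lam T ρ ha hb hl hT hρ G hG0 hG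
  have hqn : 0 ≤ eval (momentPoint a b lam T ρ) (q n) :=
    nonnegCoeff.eval_nonneg (hq n (by lia)).1 (momentPoint_nonneg ha hb hl hT)
  have hK0 := neg_cumulant_nonneg (b := b) ha hl hT hρ
  have hK := neg_cumulant_le ha hb hl hT hρ
  have h0 : momentPoint a b lam T ρ 0 = a := rfl
  have h1 : momentPoint a b lam T ρ 1 = lam := rfl
  have h2 : momentPoint a b lam T ρ 2 = 1 / b := rfl
  have h3 : momentPoint a b lam T ρ 3 = T := rfl
  have h4 : momentPoint a b lam T ρ 4 = |ρ| := rfl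
  have h5 : momentPoint a b lam T ρ 5 =
    Real.exp (-(lam * T * (a * ρ / Real.sqrt (b ^ 2 - 2 * ρ)))) := rfl
  rw [hG (n + 1) (by lia)]
  simp only [map_mul, map_add, map_sum, map_pow, eval_X, eval_C, h0, h1, h2, h3, h4, h5,
    Nat.add_sub_cancel]
  generalize -(lam * T * (a * ρ / Real.sqrt (b ^ 2 - 2 * ρ))) = K at hK0 hK
  generalize momentPoint a b lam T ρ = v at hbound hqn
  have first : K * (1 / 2 * Real.exp K + 1 / 2) * G n ≤
      1 / b ^ (n + 1) * (a * lam * T * |ρ| * ((1 / 2 * Real.exp K + 1 / 2) * eval v (q n))) :=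
    calc K * (1 / 2 * Real.exp K + 1 / 2) * G n
        ≤ K * (1 / 2 * Real.exp K + 1 / 2) * (1 / b ^ n * eval v (q n)) := by
          gcongr
          exact hbound n (by lia)
      _ ≤ a * lam * T * |ρ| / b * (1 / 2 * Real.exp K + 1 / 2) *
            (1 / b ^ n * eval v (q n)) := by gcongr
      _ = _ := by
          field_simp
          ring
  have rest : ∀ i ∈ Finset.Icc 1 (n + 1),
      (Nat.choose n (i - 1) : ℝ) * G (n + 1 - i) *
          (varphi i * a / b ^ (2 * i - 1)) * (lam * T) * |ρ| ^ i ≤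
        1 / b ^ (n + 1) * (a * lam * T * |ρ| * ((Nat.choose n (i - 1) : ℝ) * varphi i *
          eval v (q (n + 1 - i)) * (1 / b * |ρ|) ^ (i - 1))) := by
    intro i hi
    rw [Finset.mem_Icc] at hi
    obtain ⟨j, rfl⟩ := Nat.exists_eq_add_of_le' hi.1
    obtain ⟨k, rfl⟩ := Nat.exists_eq_add_of_le' (Nat.le_of_succ_le_succ hi.2)
    have hφ := varphi_nonneg (j + 1)
    rw [show k + j + 1 - (j + 1) = k by lia, show 2 * (j + 1) - 1 = 2 * j + 1 by lia,
      Nat.add_sub_cancel]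
    calc _ ≤ ((k + j).choose j : ℝ) * (1 / b ^ k * eval v (q k)) *
          (varphi (j + 1) * a / b ^ (2 * j + 1)) * (lam * T) * |ρ| ^ (j + 1) := by
          gcongr
          exact hbound k (by lia)
      _ = _ := by
          rw [mul_pow, div_pow, one_pow]
          field_simp
          ring
  refine (add_le_add first (Finset.sum_le_sum rest)).trans_eq ?_
  rw [← Finset.mul_sum, ← Finset.mul_sum]
  ring

theorem exists_isMomentBound (n : ℕ) : ∃ q, IsMomentBound n q := by
  induction n using Nat.strong_induction_on with
  | _ n ih =>
    cases n with
    | zero =>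
      refine ⟨1, one_mem _, ?_⟩
      intro a b lam T ρ _ _ _ _ _ G hG0 _
      simp [hG0]
    | succ n =>
      choose! q hq using ih
      obtain ⟨g, -, hg⟩ := exists_isMomentBound_step hq
      exact ⟨_, hg⟩

/-- For every `N ≥ 1` there is a polynomial `g_N` in six variables with nonnegative real
coefficients, depending only on `N`, such that for all `a, b, λ, T > 0` and all `ρ ≤ 0` the
sequence `(G_h)` built from the inverse Gaussian cumulant function `κ(θ) = aθ/√(b²−2θ)`
(with `κ⁽ⁱ⁾(0) = φ_i·a/b^{2i−1}`) satisfies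
`G_N ≤ (a·λ·T·|ρ|/b^N) · g_N(a, λ, 1/b, T, |ρ|, e^{−λTκ(ρ)})`. -/
theorem igOU_price_moment_bound (N : ℕ) (hN : 1 ≤ N) :
    ∃ g : MvPolynomial (Fin 6) ℝ,
      (∀ mono, 0 ≤ MvPolynomial.coeff mono g) ∧
      ∀ (a b lam T ρ : ℝ), 0 < a → 0 < b → 0 < lam → 0 < T → ρ ≤ 0 →
        ∀ G : ℕ → ℝ, G 0 = 1 →
          (∀ h : ℕ, 1 ≤ h →
            G h = -(lam * T * (a * ρ / Real.sqrt (b ^ 2 - 2 * ρ))) *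
                ((1 / 2) * Real.exp (-(lam * T * (a * ρ / Real.sqrt (b ^ 2 - 2 * ρ)))) +
                  1 / 2) * G (h - 1) +
              ∑ i ∈ Finset.Icc 1 h,
                (Nat.choose (h - 1) (i - 1) : ℝ) * G (h - i) *
                  (varphi i * a / b ^ (2 * i - 1)) * (lam * T) * |ρ| ^ i) →
          G N ≤ a * lam * T * |ρ| / b ^ N *
            MvPolynomial.eval
              ![a, lam, 1 / b, T, |ρ|,
                Real.exp (-(lam * T * (a * ρ / Real.sqrt (b ^ 2 - 2 * ρ))))] g := by
  obtain ⟨n, rfl⟩ := Nat.exists_eq_add_of_le' hN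
  choose q hq using exists_isMomentBound
  obtain ⟨g, hg, hbound⟩ := exists_isMomentBound_step (n := n) fun m _ => hq m
  refine ⟨g, hg, fun a b lam T ρ ha hb hl hT hρ G hG0 hG => ?_⟩
  refine (hbound.2 a b lam T ρ ha hb hl hT hρ G hG0 hG).trans_eq ?_
  simp only [map_mul, MvPolynomial.eval_X]
  change 1 / b ^ (n + 1) * (a * lam * T * |ρ| *
    MvPolynomial.eval (momentPoint a b lam T ρ) g) = a * lam * T * |ρ| / b ^ (n + 1) *
    MvPolynomial.eval (momentPoint a b lam T ρ) g
  ring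
end

section
/- Let λ > 0, T > 0, c ≥ 0, d ≥ 0, f ∈ ℝ, ρ̃ ∈ ℝ, and let I ⊆ ℝ be an open interval. Set α_{s,T} = (1 − e^{−λ(T−s)})/λ for s ∈ [0,T]. Suppose κ : ℝ → ℝ is k times continuously differentiable on an open set containing {θ·(c·α_{s,T} + d) + ρ̃ : s ∈ [0,T], θ ∈ I}. Define M(θ) = exp( θ·f − λ·T·κ(ρ̃) + λ·∫₀ᵀ κ(θ·(c·α_{s,T} + d) + ρ̃) ds ) for θ ∈ I. Then M is k times differentiable on I, and for every h with 1 ≤ h ≤ k and every θ ∈ I: M^{(h)}(θ) = f·M^{(h−1)}(θ) + λ·Σ_{i=1}^{h} binom(h−1, i−1)·M^{(h−i)}(θ)·∫₀ᵀ κ^{(i)}(θ·(c·α_{s,T} + d) + ρ̃)·(c·α_{s,T} + d)^i ds. -/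
/-- The kernel `α_{s,T} = (1 − e^{−λ(T−s)})/λ`. -/
noncomputable def alphaKer (lam T s : ℝ) : ℝ := (1 - Real.exp (-(lam * (T - s)))) / lam

open Set MeasureTheory Topology

/-- Near each point of an open set, a function continuous on its product with a compact interval
is bounded uniformly in the interval variable. -/
lemma exists_nhds_norm_le_of_continuousOn_prod {F : ℝ → ℝ → ℝ} {I : Set ℝ} {a b : ℝ}
    (hI : IsOpen I) (hF : ContinuousOn (Function.uncurry F) (I ×ˢ uIcc a b)) {θ : ℝ}
    (hθ : θ ∈ I) :
    ∃ K ∈ 𝓝 θ, K ⊆ I ∧ ∃ C, ∀ x ∈ K, ∀ s ∈ uIcc a b, ‖F x s‖ ≤ C := by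
  obtain ⟨K, hK, hKI, hKc⟩ := local_compact_nhds (hI.mem_nhds hθ)
  obtain ⟨C, hC⟩ := (hKc.prod isCompact_uIcc).exists_bound_of_continuousOn
    (hF.mono (prod_mono_left hKI))
  exact ⟨K, hK, hKI, C, fun x hx s hs => hC (x, s) ⟨hx, hs⟩⟩

lemma continuousOn_section_of_prod {F : ℝ → ℝ → ℝ} {I J : Set ℝ}
    (hF : ContinuousOn (Function.uncurry F) (I ×ˢ J)) {x : ℝ} (hx : x ∈ I) :
    ContinuousOn (F x) J :=
  hF.comp (f := fun s => (x, s)) (by fun_prop) fun _ hs => ⟨hx, hs⟩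

lemma aestronglyMeasurable_section_of_prod {F : ℝ → ℝ → ℝ} {I : Set ℝ} {a b : ℝ}
    (hF : ContinuousOn (Function.uncurry F) (I ×ˢ uIcc a b)) {x : ℝ} (hx : x ∈ I) :
    AEStronglyMeasurable (F x) (volume.restrict (uIoc a b)) :=
  ((continuousOn_section_of_prod hF hx).mono uIoc_subset_uIcc).aestronglyMeasurable
    measurableSet_uIoc

lemma continuousOn_intervalIntegral_of_continuousOn_prod {F : ℝ → ℝ → ℝ} {I : Set ℝ} {a b : ℝ}
    (hI : IsOpen I) (hF : ContinuousOn (Function.uncurry F) (I ×ˢ uIcc a b)) :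
    ContinuousOn (fun x => ∫ s in a..b, F x s) I := by
  intro θ hθ
  obtain ⟨K, hK, hKI, C, hC⟩ := exists_nhds_norm_le_of_continuousOn_prod hI hF hθ
  refine (intervalIntegral.continuousAt_of_dominated_interval (bound := fun _ => C)
    ?_ ?_ intervalIntegrable_const ?_).continuousWithinAt
  · filter_upwards [hK] with x hx
    exact aestronglyMeasurable_section_of_prod hF (hKI hx)
  · filter_upwards [hK] with x hx
    exact .of_forall fun s hs => hC x hx s (uIoc_subset_uIcc hs)
  · refine .of_forall fun s hs => ?_
    exact (hF.comp (f := fun x => (x, s)) (by fun_prop)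
      fun x hx => ⟨hx, uIoc_subset_uIcc hs⟩).continuousAt (hI.mem_nhds hθ)

/-- Differentiation under the integral sign for a jointly continuous derivative. -/
lemma hasDerivAt_intervalIntegral_of_continuousOn_prod {F F' : ℝ → ℝ → ℝ} {I : Set ℝ} {a b : ℝ}
    (hI : IsOpen I) (hF : ContinuousOn (Function.uncurry F) (I ×ˢ uIcc a b))
    (hF' : ContinuousOn (Function.uncurry F') (I ×ˢ uIcc a b))
    (hderiv : ∀ x ∈ I, ∀ s ∈ uIcc a b, HasDerivAt (fun y => F y s) (F' x s) x) {θ : ℝ}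
    (hθ : θ ∈ I) :
    HasDerivAt (fun x => ∫ s in a..b, F x s) (∫ s in a..b, F' θ s) θ := by
  obtain ⟨K, hK, hKI, C, hC⟩ := exists_nhds_norm_le_of_continuousOn_prod hI hF' hθ
  refine (intervalIntegral.hasDerivAt_integral_of_dominated_loc_of_deriv_le
    (bound := fun _ => C) hK ?_ (continuousOn_section_of_prod hF hθ).intervalIntegrable
    (aestronglyMeasurable_section_of_prod hF' hθ) ?_ intervalIntegrable_const ?_).2
  · filter_upwards [hK] with x hx
    exact aestronglyMeasurable_section_of_prod hF (hKI hx)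
  · exact .of_forall fun s hs x hx => hC x hx s (uIoc_subset_uIcc hs)
  · exact .of_forall fun s hs x hx => hderiv x (hKI hx) s (uIoc_subset_uIcc hs)

section AffineParameter

variable {κ w : ℝ → ℝ} {U I : Set ℝ} {ρ a b : ℝ} {k : ℕ}

lemma continuousOn_iteratedDerivWithin_affine (hU : IsOpen U) (hw : ContinuousOn w (uIcc a b))
    (hSU : ∀ θ ∈ I, ∀ s ∈ uIcc a b, θ * w s + ρ ∈ U) (hκ : ContDiffOn ℝ k κ U) {i : ℕ}
    (hi : i ≤ k) :
    ContinuousOn (Function.uncurry fun θ s => iteratedDerivWithin i κ U (θ * w s + ρ) * w s ^ i)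
      (I ×ˢ uIcc a b) := by
  have hw' : ContinuousOn (fun p : ℝ × ℝ => w p.2) (I ×ˢ uIcc a b) :=
    hw.comp continuousOn_snd fun p hp => hp.2
  refine ContinuousOn.mul ?_ (hw'.pow i)
  exact (hκ.continuousOn_iteratedDerivWithin (mod_cast hi) hU.uniqueDiffOn).comp
    ((continuousOn_fst.mul hw').add continuousOn_const) fun p hp => hSU p.1 hp.1 p.2 hp.2

lemma hasDerivAt_integral_iteratedDerivWithin_affine (hU : IsOpen U) (hI : IsOpen I)
    (hw : ContinuousOn w (uIcc a b)) (hSU : ∀ θ ∈ I, ∀ s ∈ uIcc a b, θ * w s + ρ ∈ U)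
    (hκ : ContDiffOn ℝ k κ U) {i : ℕ} (hi : i < k) {θ : ℝ} (hθ : θ ∈ I) :
    HasDerivAt (fun θ => ∫ s in a..b, iteratedDerivWithin i κ U (θ * w s + ρ) * w s ^ i)
      (∫ s in a..b, iteratedDerivWithin (i + 1) κ U (θ * w s + ρ) * w s ^ (i + 1)) θ := by
  refine hasDerivAt_intervalIntegral_of_continuousOn_prod hI
    (continuousOn_iteratedDerivWithin_affine hU hw hSU hκ hi.le)
    (continuousOn_iteratedDerivWithin_affine hU hw hSU hκ hi) (fun x hx s hs => ?_) hθ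
  have hκ' : HasDerivAt (iteratedDerivWithin i κ U)
      (iteratedDerivWithin (i + 1) κ U (x * w s + ρ)) (x * w s + ρ) := by
    rw [iteratedDerivWithin_succ]
    exact ((hκ.differentiableOn_iteratedDerivWithin (mod_cast hi) hU.uniqueDiffOn) _
      (hSU x hx s hs)).hasDerivWithinAt.hasDerivAt (hU.mem_nhds (hSU x hx s hs))
  have haff : HasDerivAt (fun y => y * w s + ρ) (w s) x := by
    simpa using ((hasDerivAt_id x).mul_const (w s)).add_const ρ
  rw [pow_succ', ← mul_assoc]
  exact (hκ'.comp x haff).mul_const (w s ^ i)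

lemma iteratedDerivWithin_integral_affine (hU : IsOpen U) (hI : IsOpen I)
    (hw : ContinuousOn w (uIcc a b)) (hSU : ∀ θ ∈ I, ∀ s ∈ uIcc a b, θ * w s + ρ ∈ U)
    (hκ : ContDiffOn ℝ k κ U) {i : ℕ} (hi : i ≤ k) :
    EqOn (iteratedDerivWithin i (fun θ => ∫ s in a..b, κ (θ * w s + ρ)) I)
      (fun θ => ∫ s in a..b, iteratedDerivWithin i κ U (θ * w s + ρ) * w s ^ i) I := by
  induction i with
  | zero => intro θ _; simp
  | succ i ih =>
    intro θ hθ
    rw [iteratedDerivWithin_succ, derivWithin_congr (ih (by lia)) (ih (by lia) hθ)]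
    exact (hasDerivAt_integral_iteratedDerivWithin_affine hU hI hw hSU hκ hi
      hθ).hasDerivWithinAt.derivWithin (hI.uniqueDiffWithinAt hθ)

lemma contDiffOn_integral_affine (hU : IsOpen U) (hI : IsOpen I)
    (hw : ContinuousOn w (uIcc a b)) (hSU : ∀ θ ∈ I, ∀ s ∈ uIcc a b, θ * w s + ρ ∈ U)
    (hκ : ContDiffOn ℝ k κ U) :
    ContDiffOn ℝ k (fun θ => ∫ s in a..b, κ (θ * w s + ρ)) I := by
  rw [contDiffOn_nat_iff_continuousOn_differentiableOn_deriv hI.uniqueDiffOn]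
  refine ⟨fun i hi => ?_, fun i hi => ?_⟩
  · exact (continuousOn_intervalIntegral_of_continuousOn_prod hI
      (continuousOn_iteratedDerivWithin_affine hU hw hSU hκ hi)).congr
      (iteratedDerivWithin_integral_affine hU hI hw hSU hκ hi)
  · refine DifferentiableOn.congr (fun θ hθ => ?_)
      (iteratedDerivWithin_integral_affine hU hI hw hSU hκ hi.le)
    exact (hasDerivAt_integral_iteratedDerivWithin_affine hU hI hw hSU hκ hi
      hθ).differentiableAt.differentiableWithinAt

end AffineParameter

/-- Leibniz recursion for the derivatives of the exponential of a function plus an affine map. -/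
lemma iteratedDerivWithin_succ_exp_affine_add {G : ℝ → ℝ} {I : Set ℝ} (hI : UniqueDiffOn ℝ I)
    {n : ℕ} (hG : ContDiffOn ℝ (n + 1) G I) (f e l : ℝ) {θ : ℝ} (hθ : θ ∈ I) :
    iteratedDerivWithin (n + 1) (fun x => Real.exp (x * f - e + l * G x)) I θ =
      f * iteratedDerivWithin n (fun x => Real.exp (x * f - e + l * G x)) I θ +
        l * ∑ i ∈ Finset.range (n + 1), (n.choose i : ℝ) *
          iteratedDerivWithin (n - i) (fun x => Real.exp (x * f - e + l * G x)) I θ *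
            iteratedDerivWithin (i + 1) G I θ := by
  set M : ℝ → ℝ := fun x => Real.exp (x * f - e + l * G x) with hM_def
  have hGn : ContDiffOn ℝ n G I := hG.of_le (by exact_mod_cast n.le_succ)
  have hM : ContDiffOn ℝ n M I := by fun_prop
  have hG' : ContDiffOn ℝ n (derivWithin G I) I := hG.derivWithin hI le_rfl
  have hMderiv : EqOn (derivWithin M I)
      (fun x => f * M x + l * (derivWithin G I * M) x) I := by
    intro x hx
    have hGx := (hG.differentiableOn (by simp) x hx).hasDerivWithinAt
    have hlin : HasDerivWithinAt (fun y => y * f - e) f I x := by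
      simpa using (((hasDerivAt_id x).mul_const f).sub_const e).hasDerivWithinAt
    refine ((hlin.add (hGx.const_mul l)).exp.derivWithin (hI x hx)).trans ?_
    simp only [hM_def, Pi.mul_apply, Pi.add_apply]
    ring
  rw [iteratedDerivWithin_succ', iteratedDerivWithin_congr hMderiv hθ,
    iteratedDerivWithin_fun_add hθ hI ((contDiffOn_const.mul hM) θ hθ)
      ((contDiffOn_const.mul (g := derivWithin G I * M) (hG'.mul hM)) θ hθ),
    iteratedDerivWithin_const_mul_field, iteratedDerivWithin_const_mul_field,
    iteratedDerivWithin_mul hθ hI (hG' θ hθ) (hM θ hθ)]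
  congr 2
  refine Finset.sum_congr rfl fun i _ => ?_
  rw [iteratedDerivWithin_succ']
  ring

/-- The recursive differentiation formula at the core of Lemma 4.1: if `κ` is `k` times
continuously differentiable on an open set `U` containing all the points
`θ(c α_{s,T} + d) + ρ̃` for `s ∈ [0,T]`, `θ` in the open interval `I`, and
`M(θ) = exp(θ f − λ T κ(ρ̃) + λ ∫₀ᵀ κ(θ(c α_{s,T} + d) + ρ̃) ds)`, then `M` is `k` times
continuously differentiable on `I`, and for `1 ≤ h ≤ k` and `θ ∈ I`,
`M⁽ʰ⁾(θ) = f M⁽ʰ⁻¹⁾(θ) + λ Σ_{i=1}^h C(h−1,i−1) M⁽ʰ⁻ⁱ⁾(θ) ∫₀ᵀ κ⁽ⁱ⁾(θ(c α + d) + ρ̃)(c α + d)ⁱ ds`. -/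
theorem mgf_iterated_deriv_recursion
    (lam T c d f ρ : ℝ) (hlam : 0 < lam) (hT : 0 < T) (hc : 0 ≤ c) (hd : 0 ≤ d)
    (A B : ℝ) (I : Set ℝ) (hI : I = Set.Ioo A B)
    (k : ℕ) (κ : ℝ → ℝ) (U : Set ℝ) (hUopen : IsOpen U)
    (hSU : ∀ θ ∈ I, ∀ s ∈ Set.Icc (0 : ℝ) T, θ * (c * alphaKer lam T s + d) + ρ ∈ U)
    (hκ : ContDiffOn ℝ k κ U)
    (M : ℝ → ℝ)
    (hM : ∀ θ : ℝ, M θ = Real.exp (θ * f - lam * T * κ ρ +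
      lam * ∫ s in (0 : ℝ)..T, κ (θ * (c * alphaKer lam T s + d) + ρ))) :
    ContDiffOn ℝ k M I ∧
    ∀ h : ℕ, 1 ≤ h → h ≤ k → ∀ θ ∈ I,
      iteratedDerivWithin h M I θ =
        f * iteratedDerivWithin (h - 1) M I θ +
          lam * ∑ i ∈ Finset.Icc 1 h,
            (Nat.choose (h - 1) (i - 1) : ℝ) * iteratedDerivWithin (h - i) M I θ *
              ∫ s in (0 : ℝ)..T,
                iteratedDerivWithin i κ U (θ * (c * alphaKer lam T s + d) + ρ) *
                  (c * alphaKer lam T s + d) ^ i := by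
  obtain rfl : M = fun θ => Real.exp (θ * f - lam * T * κ ρ +
      lam * ∫ s in (0 : ℝ)..T, κ (θ * (c * alphaKer lam T s + d) + ρ)) := funext hM
  have hIo : IsOpen I := hI ▸ isOpen_Ioo
  have hw : ContinuousOn (fun s => c * alphaKer lam T s + d) (uIcc 0 T) := by
    unfold alphaKer
    fun_prop
  rw [← uIcc_of_le hT.le] at hSU
  have hG := contDiffOn_integral_affine hUopen hIo hw hSU hκ
  refine ⟨by fun_prop, fun h h1 hk θ hθ => ?_⟩
  obtain ⟨n, rfl⟩ : ∃ n, h = n + 1 := ⟨h - 1, by lia⟩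
  rw [iteratedDerivWithin_succ_exp_affine_add hIo.uniqueDiffOn
    (hG.of_le (by exact_mod_cast hk)) f _ lam hθ, ← Finset.Ico_add_one_right_eq_Icc,
    Finset.sum_Ico_eq_sum_range]
  simp only [Nat.add_sub_cancel]
  congr 2
  refine Finset.sum_congr rfl fun i hi => ?_
  have hi' : i + 1 ≤ k := by grind
  rw [iteratedDerivWithin_integral_affine hUopen hIo hw hSU hκ hi', add_comm 1 i,
    Nat.add_sub_cancel, Nat.add_sub_add_right]
  exact hθ
end
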